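/- For every j ∈ {2,3,4} and λ ∈ {1,-1}, there do not exist nowhere-vanishing smooth functions m, n : ℝ³ → ℝ and a nonzero constant vector C ∈ ℝ⁴ such that L₁N(s,t,w) = m(s,t,w)·N(s,t,w) + n(s,t,w)·C for all (s,t,w) ∈ ℝ³. In other words, no tubular hypersurface obtained by pseudo hyperspheres or pseudo hyperbolic hyperspheres whose centers lie on a spacelike curve with non-null Frenet vector fields in E⁴₁ has generalized L₁ 1-type Gauss map. -/

import Mathlib

noncomputable section

open Real

set_option linter.unusedVariables false

/-- Minkowski inner product on `ℝ⁴` with signature `(-,+,+,+)`. -/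
def mink (u v : Fin 4 → ℝ) : ℝ :=
  -(u 0 * v 0) + u 1 * v 1 + u 2 * v 2 + u 3 * v 3

/-- `εᵢ = ⟨Fᵢ,Fᵢ⟩` : equals `-1` if `i = j` and `1` otherwise. -/
def eps (j i : ℕ) : ℝ := if i = j then -1 else 1

/-- `σ = 1` if `j = 2` and `σ = -1` if `j ∈ {3,4}`. -/
def sigma' (j : ℕ) : ℝ := if j = 2 then 1 else -1

/-- `τ = 1` if `j ∈ {2,3}` and `τ = -1` if `j = 4`. -/
def tau' (j : ℕ) : ℝ := if j = 4 then -1 else 1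

/-- The functions `μ₂, μ₃, μ₄` defined by the cyclic index rule
(`μ₅ := μ₂`, `μ₆ := μ₃`): `μⱼ = cosh t·sinh w`, `μⱼ₊₁ = cosh w`,
`μⱼ₊₂ = sinh t·sinh w` if `λ = 1`, and `μⱼ = cosh t·cosh w`,
`μⱼ₊₁ = sinh w`, `μⱼ₊₂ = sinh t·cosh w` if `λ = -1`. -/
def mu (j : ℕ) (lam : ℝ) (i : ℕ) (t w : ℝ) : ℝ :=
  if (i + 3 - j) % 3 = 0 then cosh t * (if lam = 1 then sinh w else cosh w)
  else if (i + 3 - j) % 3 = 1 then (if lam = 1 then cosh w else sinh w)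
  else sinh t * (if lam = 1 then sinh w else cosh w)

/-- Gauss map of the tubular hypersurface `T^{j,λ}` about a spacelike curve of type `j`. -/
def gaussNJ (j : ℕ) (lam : ℝ) (F₂ F₃ F₄ : ℝ → Fin 4 → ℝ) (s t w : ℝ) : Fin 4 → ℝ :=
  (-(sigma' j) * lam ^ j) •
    (mu j lam 2 t w • F₂ s + mu j lam 3 t w • F₃ s + mu j lam 4 t w • F₄ s)

/-- The tubular hypersurface `T^{j,λ}` about a spacelike curve of type `j`. -/
def tubeTJ (j : ℕ) (lam r : ℝ) (β F₂ F₃ F₄ : ℝ → Fin 4 → ℝ) (s t w : ℝ) : Fin 4 → ℝ :=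
  β s + r • (mu j lam 2 t w • F₂ s + mu j lam 3 t w • F₃ s + mu j lam 4 t w • F₄ s)

/-- The function `D(s,t,w) = σ + r k₁(s) μ₂(t,w)`. -/
def DJ (j : ℕ) (lam r : ℝ) (k₁ : ℝ → ℝ) (s t w : ℝ) : ℝ :=
  sigma' j + r * k₁ s * mu j lam 2 t w

/-- The Cheng–Yau operator `ℒ₁` applied to the Gauss map of `T^{j,λ}`. -/
def L1NJ (j : ℕ) (lam r : ℝ) (k₁ k₂ : ℝ → ℝ) (F₁ F₂ F₃ F₄ : ℝ → Fin 4 → ℝ)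
    (s t w : ℝ) : Fin 4 → ℝ :=
  (2 * (-(tau' j) * k₁ s * k₂ s * mu j lam 3 t w + deriv k₁ s * mu j lam 2 t w)
      / (r * (DJ j lam r k₁ s t w) ^ 3)) • F₁ s
  + (-2 * lam * (mu j lam 2 t w + 3 * r ^ 2 * (k₁ s) ^ 2 * (mu j lam 2 t w) ^ 3
      + k₁ s * (lam * r + 4 * sigma' j * r * (mu j lam 2 t w) ^ 2))
      / (r ^ 3 * (DJ j lam r k₁ s t w) ^ 2)) • F₂ s
  + (-2 * lam * sigma' j * mu j lam 3 t w * (1 + 3 * sigma' j * r * k₁ s * mu j lam 2 t w)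
      / (r ^ 3 * DJ j lam r k₁ s t w)) • F₃ s
  + (-2 * lam * mu j lam 4 t w * (sigma' j + 3 * r * k₁ s * mu j lam 2 t w)
      / (r ^ 3 * DJ j lam r k₁ s t w)) • F₄ s

/-- The operator `ℒ₂` applied to the Gauss map of `T^{j,λ}`. -/
def L2NJ (j : ℕ) (lam r : ℝ) (k₁ k₂ : ℝ → ℝ) (F₁ F₂ F₃ F₄ : ℝ → Fin 4 → ℝ)
    (s t w : ℝ) : Fin 4 → ℝ :=
  (lam ^ j * ((-1 : ℝ) ^ j * mu j lam 3 t w * k₁ s * k₂ s - sigma' j * mu j lam 2 t w * deriv k₁ s)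
      / (r ^ 2 * (DJ j lam r k₁ s t w) ^ 3)) • F₁ s
  + (-lam ^ (j + 1) * k₁ s * (2 * lam * sigma' j - 3 * (-1 : ℝ) ^ j * (mu j lam 4 t w) ^ 2
      - 3 * tau' j * (mu j lam 3 t w) ^ 2 - 3 * sigma' j * r * k₁ s * (mu j lam 2 t w) ^ 3)
      / (r ^ 3 * (DJ j lam r k₁ s t w) ^ 2)) • F₂ s
  + (3 * tau' j * lam ^ (j + 1) * r * k₁ s * mu j lam 2 t w * mu j lam 3 t w
      / (r ^ 4 * (tau' j + (-1 : ℝ) ^ j * r * k₁ s * mu j lam 2 t w))) • F₃ s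
  + (3 * tau' j * lam ^ (j + 1) * r * k₁ s * mu j lam 2 t w * mu j lam 4 t w
      / (r ^ 4 * (tau' j + (-1 : ℝ) ^ j * r * k₁ s * mu j lam 2 t w))) • F₄ s

theorem mink_add_left (u v x : Fin 4 → ℝ) : mink (u + v) x = mink u x + mink v x := by
  simp only [mink, Pi.add_apply]; ring

theorem mink_smul_left (c : ℝ) (u x : Fin 4 → ℝ) : mink (c • u) x = c * mink u x := by
  simp only [mink, Pi.smul_apply, smul_eq_mul]; ring

theorem mink_comm (u v : Fin 4 → ℝ) : mink u v = mink v u := by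
  simp only [mink]; ring

theorem hasDerivAt_mink_left (C : Fin 4 → ℝ) {F : ℝ → Fin 4 → ℝ} {F' : Fin 4 → ℝ} {s : ℝ}
    (h : HasDerivAt F F' s) : HasDerivAt (fun x => mink C (F x)) (mink C F') s := by
  have h := hasDerivAt_pi.1 h
  exact ((((h 0).const_mul (C 0)).neg.add ((h 1).const_mul (C 1))).add
    ((h 2).const_mul (C 2))).add ((h 3).const_mul (C 3))

theorem eps_mul_self (j i : ℕ) : eps j i * eps j i = 1 := by
  unfold eps; split_ifs <;> norm_num

theorem eps_ne_zero (j i : ℕ) : eps j i ≠ 0 := by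
  unfold eps; split_ifs <;> norm_num

theorem sigma'_mul_self (j : ℕ) : sigma' j * sigma' j = 1 := by
  unfold sigma'; split_ifs <;> norm_num

theorem mu_linearIndependent {j : ℕ} (hj : j = 2 ∨ j = 3 ∨ j = 4) {lam : ℝ}
    (hlam : lam = 1 ∨ lam = -1) {x y z : ℝ}
    (h : ∀ t w, x * mu j lam 2 t w + y * mu j lam 3 t w + z * mu j lam 4 t w = 0) :
    x = 0 ∧ y = 0 ∧ z = 0 := by
  have hs : sinh 1 ≠ 0 := (sinh_pos_iff.2 one_pos).ne'
  have hc : cosh 1 ≠ 0 := (cosh_pos 1).ne'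
  have hn : (-1 : ℝ) ≠ 1 := by norm_num
  have h₀₀ := h 0 0
  have h₀₁ := h 0 1
  have h₁₀ := h 1 0
  have h₁₁ := h 1 1
  rcases hj with rfl | rfl | rfl <;> rcases hlam with rfl | rfl <;>
    simp [mu, hn] at h₀₀ h₀₁ h₁₀ h₁₁ <;> simp_all

/-- The functions `μ₃`, `μ₂ μ₃`, `μ₃²` of `(t, w)` satisfy no linear relation involving `μ₃`. -/
theorem coeff_eq_zero_of_mu_three_mul {j : ℕ} (hj : j = 2 ∨ j = 3 ∨ j = 4) {lam : ℝ}
    (hlam : lam = 1 ∨ lam = -1) {x y z : ℝ}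
    (h : ∀ t w, mu j lam 3 t w * (x + y * mu j lam 2 t w + z * mu j lam 3 t w) = 0) :
    x = 0 := by
  have hs : 0 < sinh 1 := sinh_pos_iff.2 one_pos
  have hc : 0 < cosh 1 := cosh_pos 1
  have hlt : cosh 1 < cosh 2 := by rw [cosh_lt_cosh]; norm_num
  have hc₂ : 0 < cosh 2 := cosh_pos 2
  have hs₂ : 0 < sinh 2 := sinh_pos_iff.2 two_pos
  have hn : (-1 : ℝ) ≠ 1 := by norm_num
  have key : ∀ v, x + v * cosh 1 = 0 → x + v * cosh 2 = 0 → x = 0 := by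
    intro v h₁ h₂
    have hv : v * (cosh 2 - cosh 1) = 0 := by linear_combination h₂ - h₁
    have : v = 0 := (mul_eq_zero.1 hv).resolve_right (sub_pos.2 hlt).ne'
    simpa [this] using h₁
  have h₁ := h 1 1
  have h₂ := h 1 (-1)
  have h₃ := h (-1) 1
  have h₄ := h (-1) (-1)
  have h₅ := h 0 1
  have h₆ := h 0 2
  have h₇ := h 0 (-1)
  have h₈ := h 0 (-2)
  have h₉ := h 1 2
  have h₁₀ := h (-1) 2
  rcases hj with rfl | rfl | rfl <;> rcases hlam with rfl | rfl <;>
    simp [mu, hn, hs.ne', hc.ne', hs₂.ne', hc₂.ne'] at h₁ h₂ h₃ h₄ h₅ h₆ h₇ h₈ h₉ h₁₀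
  · exact key z (by linear_combination (h₅ + h₇) / 2) (by linear_combination (h₆ + h₈) / 2)
  · exact key y (by linear_combination (h₅ + h₇) / 2) (by linear_combination (h₆ + h₈) / 2)
  · linear_combination (h₁ + h₂) / 2
  · exact key z h₅ h₆
  · exact key y (by linear_combination (h₁ + h₃) / 2) (by linear_combination (h₉ + h₁₀) / 2)
  · linear_combination (h₁ + h₄) / 2

theorem no_generalized_L1_one_type_gauss_map_spacelike
    (j : ℕ) (hj : j = 2 ∨ j = 3 ∨ j = 4) (lam : ℝ) (hlam : lam = 1 ∨ lam = -1)
    (r : ℝ) (hr : 0 < r)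
    (β F₁ F₂ F₃ F₄ : ℝ → Fin 4 → ℝ) (k₁ k₂ k₃ : ℝ → ℝ)
    (hβ : ContDiff ℝ (⊤ : ℕ∞) β) (hF₁ : ContDiff ℝ (⊤ : ℕ∞) F₁) (hF₂ : ContDiff ℝ (⊤ : ℕ∞) F₂)
    (hF₃ : ContDiff ℝ (⊤ : ℕ∞) F₃) (hF₄ : ContDiff ℝ (⊤ : ℕ∞) F₄)
    (hk₁ : ContDiff ℝ (⊤ : ℕ∞) k₁) (hk₂ : ContDiff ℝ (⊤ : ℕ∞) k₂) (hk₃ : ContDiff ℝ (⊤ : ℕ∞) k₃)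
    (hβ' : ∀ s, deriv β s = F₁ s)
    (hF₁₁ : ∀ s, mink (F₁ s) (F₁ s) = eps j 1)
    (hF₂₂ : ∀ s, mink (F₂ s) (F₂ s) = eps j 2)
    (hF₃₃ : ∀ s, mink (F₃ s) (F₃ s) = eps j 3)
    (hF₄₄ : ∀ s, mink (F₄ s) (F₄ s) = eps j 4)
    (hF₁₂ : ∀ s, mink (F₁ s) (F₂ s) = 0)
    (hF₁₃ : ∀ s, mink (F₁ s) (F₃ s) = 0)
    (hF₁₄ : ∀ s, mink (F₁ s) (F₄ s) = 0)
    (hF₂₃ : ∀ s, mink (F₂ s) (F₃ s) = 0)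
    (hF₂₄ : ∀ s, mink (F₂ s) (F₄ s) = 0)
    (hF₃₄ : ∀ s, mink (F₃ s) (F₄ s) = 0)
    (hFr₁ : ∀ s, deriv F₁ s = k₁ s • F₂ s)
    (hFr₂ : ∀ s, deriv F₂ s = (-(eps j 1 * eps j 2) * k₁ s) • F₁ s + k₂ s • F₃ s)
    (hFr₃ : ∀ s, deriv F₃ s = (-(eps j 2 * eps j 3) * k₂ s) • F₂ s + k₃ s • F₄ s)
    (hFr₄ : ∀ s, deriv F₄ s = (-(eps j 3 * eps j 4) * k₃ s) • F₃ s)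
    (hD : ∀ s t w : ℝ, DJ j lam r k₁ s t w ≠ 0)
    :
    ¬ ∃ (m n : ℝ × ℝ × ℝ → ℝ) (C : Fin 4 → ℝ),
      ContDiff ℝ (⊤ : ℕ∞) m ∧ ContDiff ℝ (⊤ : ℕ∞) n ∧ (∀ p, m p ≠ 0) ∧ (∀ p, n p ≠ 0) ∧ C ≠ 0 ∧
        ∀ s t w : ℝ, L1NJ j lam r k₁ k₂ F₁ F₂ F₃ F₄ s t w
          = m (s, t, w) • gaussNJ j lam F₂ F₃ F₄ s t w + n (s, t, w) • C := by
  rintro ⟨m, n, C, -, -, -, hn, hC, hL⟩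
  have hr₀ : r ≠ 0 := hr.ne'
  have hl : lam * lam = 1 := by rcases hlam with rfl | rfl <;> norm_num
  have hσ := sigma'_mul_self j
  have hF₂₁ : ∀ s, mink (F₂ s) (F₁ s) = 0 := fun s => by rw [mink_comm, hF₁₂]
  have hF₃₁ : ∀ s, mink (F₃ s) (F₁ s) = 0 := fun s => by rw [mink_comm, hF₁₃]
  have hF₄₁ : ∀ s, mink (F₄ s) (F₁ s) = 0 := fun s => by rw [mink_comm, hF₁₄]
  have hF₃₂ : ∀ s, mink (F₃ s) (F₂ s) = 0 := fun s => by rw [mink_comm, hF₂₃]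
  have hF₄₂ : ∀ s, mink (F₄ s) (F₂ s) = 0 := fun s => by rw [mink_comm, hF₂₄]
  have hF₄₃ : ∀ s, mink (F₄ s) (F₃ s) = 0 := fun s => by rw [mink_comm, hF₃₄]
  have e₁ := eps_mul_self j 1
  have e₂ := eps_mul_self j 2
  have e₃ := eps_mul_self j 3
  have e₄ := eps_mul_self j 4
  set q₁ : ℝ → ℝ := fun s => eps j 1 * mink C (F₁ s) with hq₁
  set q₂ : ℝ → ℝ := fun s => eps j 2 * mink C (F₂ s) with hq₂
  set q₃ : ℝ → ℝ := fun s => eps j 3 * mink C (F₃ s) with hq₃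
  set q₄ : ℝ → ℝ := fun s => eps j 4 * mink C (F₄ s) with hq₄
  have hcomp : ∀ s t w, ∃ M : ℝ, M = m (s, t, w) * (-(sigma' j) * lam ^ j) ∧
      2 * (-(tau' j) * k₁ s * k₂ s * mu j lam 3 t w + deriv k₁ s * mu j lam 2 t w)
        / (r * (DJ j lam r k₁ s t w) ^ 3) = n (s, t, w) * q₁ s ∧
      -2 * lam * (mu j lam 2 t w + 3 * r ^ 2 * (k₁ s) ^ 2 * (mu j lam 2 t w) ^ 3
        + k₁ s * (lam * r + 4 * sigma' j * r * (mu j lam 2 t w) ^ 2))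
        / (r ^ 3 * (DJ j lam r k₁ s t w) ^ 2) = M * mu j lam 2 t w + n (s, t, w) * q₂ s ∧
      -2 * lam * sigma' j * mu j lam 3 t w * (1 + 3 * sigma' j * r * k₁ s * mu j lam 2 t w)
        / (r ^ 3 * DJ j lam r k₁ s t w) = M * mu j lam 3 t w + n (s, t, w) * q₃ s ∧
      -2 * lam * mu j lam 4 t w * (sigma' j + 3 * r * k₁ s * mu j lam 2 t w)
        / (r ^ 3 * DJ j lam r k₁ s t w) = M * mu j lam 4 t w + n (s, t, w) * q₄ s := by
    intro s t w
    have h₁ := congrArg (mink · (F₁ s)) (hL s t w)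
    have h₂ := congrArg (mink · (F₂ s)) (hL s t w)
    have h₃ := congrArg (mink · (F₃ s)) (hL s t w)
    have h₄ := congrArg (mink · (F₄ s)) (hL s t w)
    simp only [L1NJ, gaussNJ, mink_add_left, mink_smul_left, hF₁₁, hF₂₂, hF₃₃, hF₄₄, hF₁₂, hF₁₃,
      hF₁₄, hF₂₃, hF₂₄, hF₃₄, hF₂₁, hF₃₁, hF₄₁, hF₃₂, hF₄₂, hF₄₃, mul_zero, add_zero,
      zero_add] at h₁ h₂ h₃ h₄
    refine ⟨_, rfl, ?_, ?_, ?_, ?_⟩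
    · refine mul_right_cancel₀ (eps_ne_zero j 1) (h₁.trans ?_)
      linear_combination (-n (s, t, w) * mink C (F₁ s)) * e₁
    · refine mul_right_cancel₀ (eps_ne_zero j 2) (h₂.trans ?_)
      linear_combination (-n (s, t, w) * mink C (F₂ s)) * e₂
    · refine mul_right_cancel₀ (eps_ne_zero j 3) (h₃.trans ?_)
      linear_combination (-n (s, t, w) * mink C (F₃ s)) * e₃
    · refine mul_right_cancel₀ (eps_ne_zero j 4) (h₄.trans ?_)
      linear_combination (-n (s, t, w) * mink C (F₄ s)) * e₄
  have hq₃₄ : ∀ s, q₃ s = 0 ∧ q₄ s = 0 := by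
    intro s
    have := mu_linearIndependent hj hlam (x := 0) (y := -q₄ s) (z := q₃ s) fun t w => by
      obtain ⟨M, -, -, -, h₃, h₄⟩ := hcomp s t w
      refine (mul_eq_zero.1 (?_ : n (s, t, w) * _ = 0)).resolve_left (hn _)
      have h : -2 * lam * sigma' j * mu j lam 3 t w
            * (1 + 3 * sigma' j * r * k₁ s * mu j lam 2 t w)
            / (r ^ 3 * DJ j lam r k₁ s t w) * mu j lam 4 t w
          = -2 * lam * mu j lam 4 t w * (sigma' j + 3 * r * k₁ s * mu j lam 2 t w)
            / (r ^ 3 * DJ j lam r k₁ s t w) * mu j lam 3 t w := by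
        rw [div_mul_eq_mul_div, div_mul_eq_mul_div]
        congr 1
        linear_combination (-6 * lam * mu j lam 3 t w * r * k₁ s * mu j lam 2 t w
          * mu j lam 4 t w) * hσ
      rw [h₃, h₄] at h
      linear_combination h
    exact ⟨this.2.2, neg_eq_zero.1 this.2.1⟩
  have hq₂' : ∀ s t w, mu j lam 3 t w * (n (s, t, w) * q₂ s * (r ^ 2 * DJ j lam r k₁ s t w ^ 2)
      + 2 * k₁ s) = 0 := by
    intro s t w
    obtain ⟨M, -, -, h₂, h₃, -⟩ := hcomp s t w
    rw [(hq₃₄ s).1] at h₃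
    have hd := hD s t w
    rw [div_eq_iff (by positivity)] at h₂ h₃
    refine (mul_eq_zero.1 (?_ : r * _ = 0)).resolve_left hr₀
    have hDdef : DJ j lam r k₁ s t w = sigma' j + r * k₁ s * mu j lam 2 t w := rfl
    rw [hDdef] at h₂ h₃ ⊢
    linear_combination (-mu j lam 3 t w) * h₂
      + (mu j lam 2 t w * (sigma' j + r * k₁ s * mu j lam 2 t w)) * h₃
      + (2 * lam * mu j lam 2 t w * mu j lam 3 t w * (1 + 3 * sigma' j * r * k₁ s * mu j lam 2 t w
        + 3 * r ^ 2 * k₁ s ^ 2 * mu j lam 2 t w ^ 2)) * hσ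
      - (2 * k₁ s * r * mu j lam 3 t w) * hl
  have hpt : ∀ s, k₁ s ≠ 0 → q₁ s = 0 ∧ q₂ s ≠ 0 := by
    intro s hk
    constructor
    · have := coeff_eq_zero_of_mu_three_mul hj hlam (x := q₁ s * k₁ s * sigma' j)
        (y := r * q₂ s * deriv k₁ s + q₁ s * k₁ s * (r * k₁ s))
        (z := -(r * q₂ s * tau' j * k₁ s * k₂ s)) fun t w => by
          obtain ⟨M, -, h₁, -⟩ := hcomp s t w
          have hd := hD s t w
          have h := hq₂' s t w
          have hDdef : DJ j lam r k₁ s t w = sigma' j + r * k₁ s * mu j lam 2 t w := rfl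
          rw [div_eq_iff (by positivity)] at h₁
          generalize DJ j lam r k₁ s t w = D at *
          linear_combination (q₂ s * r * mu j lam 3 t w / 2) * h₁ + (q₁ s * D / 2) * h
            - (q₁ s * k₁ s * mu j lam 3 t w) * hDdef
      have hσ₀ : sigma' j ≠ 0 := left_ne_zero_of_mul_eq_one hσ
      simpa [hk, hσ₀] using this
    · intro h₀
      have := mu_linearIndependent hj hlam (x := 0) (y := 2 * k₁ s) (z := 0) fun t w => by
        have h := hq₂' s t w
        rw [h₀] at h
        linear_combination h
      exact hk (by linarith [this.2.1])
  have hk₀ : ∀ s, k₁ s = 0 := by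
    intro s
    by_contra hk
    have hev : (fun x => mink C (F₁ x)) =ᶠ[nhds s] fun _ => 0 := by
      filter_upwards [hk₁.continuous.continuousAt.eventually_ne hk] with x hx
      exact (mul_eq_zero.1 (hpt x hx).1).resolve_left (eps_ne_zero j 1)
    have hd : HasDerivAt F₁ (k₁ s • F₂ s) s :=
      hFr₁ s ▸ ((hF₁.differentiable (by simp)) s).hasDerivAt
    have h := ((hasDerivAt_mink_left C hd).congr_of_eventuallyEq hev.symm).unique
      (hasDerivAt_const s (0 : ℝ))
    rw [mink_comm, mink_smul_left, mink_comm] at h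
    exact (hpt s hk).2 (by simp [hq₂, (mul_eq_zero.1 h).resolve_left hk])
  have hk₁' : deriv k₁ 0 = 0 := by
    rw [show k₁ = fun _ => 0 from funext hk₀]; simp
  have hq₂₀ : q₂ 0 = 0 := by
    refine (mu_linearIndependent hj hlam (x := 0) (y := q₂ 0) (z := 0) fun t w => ?_).2.1
    have h := hq₂' 0 t w
    have hd : n (0, t, w) * (r ^ 2 * DJ j lam r k₁ 0 t w ^ 2) ≠ 0 :=
      mul_ne_zero (hn _) (mul_ne_zero (pow_ne_zero _ hr₀) (pow_ne_zero _ (hD 0 t w)))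
    rw [hk₀] at h
    refine (mul_eq_zero.1 ?_).resolve_left hd
    linear_combination h
  obtain ⟨M, hM, h₁, h₂, h₃, h₄⟩ := hcomp 0 0 0
  have hq₁₀ : q₁ 0 = 0 := by
    rw [hk₀, hk₁'] at h₁
    exact (mul_eq_zero.1 (by rw [← h₁]; simp)).resolve_left (hn (0, 0, 0))
  have hv := hL 0 0 0
  rw [L1NJ, h₁, h₂, h₃, h₄, hq₁₀, hq₂₀, (hq₃₄ 0).1, (hq₃₄ 0).2, gaussNJ, hM] at hv
  refine hC ((smul_eq_zero.1 (?_ : n (0, 0, 0) • C = 0)).resolve_left (hn _))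
  rw [← sub_eq_iff_eq_add'] at hv
  rw [← hv]
  module
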